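/- Let ψ : X → Y be any output (monitor) function and let S be a finite set of nonempty input traces (lists over U). If C is an executable simulation campaign whose output-trace sequence is a permutation of (an enumeration of) S, then the list of outputs collected at the out commands of C — i.e., ψ applied to the system-state component of the traversed simulator state at each out command — is exactly the list of values ψ(List.foldl δ x0 T) for T ranging over the output-trace sequence; in particular, the set of collected outputs equals { ψ(List.foldl δ x0 T) : T ∈ S }, the answer to the system-level formal verification problem on S. -/

import Mathlib

/-- Simulator commands: `out`, `load id`, `store id`, `free id`, and `run u k`
(with `k` a positive natural number, the duration of the run). -/
inductive SimCmd (U : Type*) (ID : Type*) where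
  | out : SimCmd U ID
  | load (id : ID) : SimCmd U ID
  | store (id : ID) : SimCmd U ID
  | free (id : ID) : SimCmd U ID
  | run (u : U) (k : ℕ+) : SimCmd U ID

/-- A simulator state: either a triple `(x, w, m)` (system state, input trace injected so
far, simulator memory as a finite partial map from identifiers to pairs of a system state
and an input trace), or a distinguished error state. -/
inductive SimState (X : Type*) (U : Type*) (ID : Type*) where
  | ok (x : X) (w : List U) (m : Finmap (fun _ : ID => X × List U)) : SimState X U ID
  | err : SimState X U ID

variable {X U ID : Type*} [DecidableEq ID]

/-- Semantics of simulator commands on simulator states. -/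
def SimState.step (δ : X → U → X) : SimState X U ID → SimCmd U ID → SimState X U ID
  | .err, _ => .err
  | .ok x w m, .out => .ok x w m
  | .ok _ _ m, .load id =>
      match m.lookup id with
      | some p => .ok p.1 p.2 m
      | none => .err
  | .ok x w m, .store id =>
      match m.lookup id with
      | some _ => .err
      | none => .ok x w (m.insert id (x, w))
  | .ok x w m, .free id =>
      match m.lookup id with
      | some _ => .ok x w (m.erase id)
      | none => .err
  | .ok x w m, .run u k =>
      .ok (List.foldl δ x (List.replicate k u)) (w ++ List.replicate k u) m

/-- The initial simulator state `(x0, [], ∅)`. -/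
def initState (x0 : X) : SimState X U ID := .ok x0 [] ∅

/-- The simulator states traversed by a simulation campaign (a list of commands),
starting from the initial simulator state. -/
def traversed (δ : X → U → X) (x0 : X) (C : List (SimCmd U ID)) : List (SimState X U ID) :=
  List.scanl (SimState.step δ) (initState x0) C

/-- A simulation campaign is executable if none of its traversed states is the error state. -/
def Executable (δ : X → U → X) (x0 : X) (C : List (SimCmd U ID)) : Prop :=
  ∀ s ∈ traversed δ x0 C, s ≠ SimState.err

/-- The time advancement of a single command. -/
def cmdLen : SimCmd U ID → ℕ
  | .run _ k => k
  | _ => 0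

/-- The length of a simulation campaign: the sum of the durations of its run commands. -/
def campaignLen (C : List (SimCmd U ID)) : ℕ := (C.map cmdLen).sum

/-- The number of entries in the memory of a simulator state. -/
def memSize : SimState X U ID → ℕ
  | .ok _ _ m => m.keys.card
  | .err => 0

/-- The required simulator memory of a campaign: the maximum number of memory entries
over its traversed states. -/
def requiredMem (δ : X → U → X) (x0 : X) (C : List (SimCmd U ID)) : ℕ :=
  ((traversed δ x0 C).map memSize).foldr max 0

/-- The output-trace sequence of a campaign run from a given simulator state: the list of
the `w`-components of the states at which its `out` commands are executed. -/
def outputsFrom (δ : X → U → X) : SimState X U ID → List (SimCmd U ID) → List (List U)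
  | _, [] => []
  | s, c :: rest =>
      (match c, s with
       | .out, .ok _ w _ => [w]
       | _, _ => []) ++ outputsFrom δ (SimState.step δ s c) rest

/-- The output-trace sequence of a simulation campaign. -/
def outputs (δ : X → U → X) (x0 : X) (C : List (SimCmd U ID)) : List (List U) :=
  outputsFrom δ (initState x0) C

/-- The list of outputs collected at the `out` commands of a campaign run from a given
simulator state: `ψ` applied to the system-state component of the traversed simulator
state at each `out` command. -/
def collectedFrom {Y : Type*} (δ : X → U → X) (ψ : X → Y) :
    SimState X U ID → List (SimCmd U ID) → List Y
  | _, [] => []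
  | s, c :: rest =>
      (match c, s with
       | .out, .ok x _ _ => [ψ x]
       | _, _ => []) ++ collectedFrom δ ψ (SimState.step δ s c) rest

/-- The list of outputs collected at the `out` commands of a simulation campaign. -/
def collected {Y : Type*} (δ : X → U → X) (ψ : X → Y) (x0 : X)
    (C : List (SimCmd U ID)) : List Y :=
  collectedFrom δ ψ (initState x0) C

/-- The consistency invariant: every system state, current or stored in memory, is the one
reached from `x0` by injecting the input trace recorded next to it. -/
def SimState.Consistent (δ : X → U → X) (x0 : X) : SimState X U ID → Prop
  | .ok x w m => x = List.foldl δ x0 w ∧ ∀ id p, m.lookup id = some p → p.1 = List.foldl δ x0 p.2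
  | .err => True

theorem SimState.consistent_initState (δ : X → U → X) (x0 : X) :
    (initState x0 : SimState X U ID).Consistent δ x0 :=
  ⟨rfl, fun id p h => by simp at h⟩

theorem SimState.Consistent.step {δ : X → U → X} {x0 : X} {s : SimState X U ID}
    (hs : s.Consistent δ x0) (c : SimCmd U ID) : (s.step δ c).Consistent δ x0 := by
  cases s with
  | err => trivial
  | ok x w m =>
    obtain ⟨hx, hm⟩ := hs
    cases c with
    | out => exact ⟨hx, hm⟩
    | load id =>
      cases h : m.lookup id with
      | none => simp [SimState.step, h, SimState.Consistent]
      | some p =>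
        simp only [SimState.step, h]
        exact ⟨hm id p h, hm⟩
    | store id =>
      cases h : m.lookup id with
      | some p => simp [SimState.step, h, SimState.Consistent]
      | none =>
        simp only [SimState.step, h]
        refine ⟨hx, fun id' p hp => ?_⟩
        by_cases hid : id' = id
        · subst hid
          rw [Finmap.lookup_insert, Option.some.injEq] at hp
          subst hp
          exact hx
        · rw [Finmap.lookup_insert_of_ne _ hid] at hp
          exact hm id' p hp
    | free id =>
      cases h : m.lookup id with
      | none => simp [SimState.step, h, SimState.Consistent]
      | some p =>
        simp only [SimState.step, h]
        refine ⟨hx, fun id' p hp => ?_⟩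
        by_cases hid : id' = id
        · subst hid
          simp [Finmap.lookup_erase] at hp
        · rw [Finmap.lookup_erase_ne hid] at hp
          exact hm id' p hp
    | run u k => exact ⟨by rw [List.foldl_append, hx], hm⟩

theorem collectedFrom_eq_map_outputsFrom {Y : Type*} {δ : X → U → X} {x0 : X} (ψ : X → Y)
    (C : List (SimCmd U ID)) {s : SimState X U ID} (hs : s.Consistent δ x0) :
    collectedFrom δ ψ s C =
      (outputsFrom δ s C).map (fun T => ψ (List.foldl δ x0 T)) := by
  induction C generalizing s with
  | nil => rfl
  | cons c C ih =>
    simp only [collectedFrom, outputsFrom, List.map_append, ih (hs.step c)]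
    congr 1
    cases s with
    | err => cases c <;> rfl
    | ok x w m =>
      cases c with
      | out => simp [hs.1]
      | _ => rfl

/-- For any output (monitor) function `ψ : X → Y` and any finite set `S` of
nonempty input traces, if `C` is an executable simulation campaign whose output-trace
sequence is a permutation of an enumeration of `S`, then the list of outputs collected at
the `out` commands of `C` is exactly the list of values `ψ (List.foldl δ x0 T)` for `T`
ranging over the output-trace sequence; in particular, the set of collected outputs
equals `{ψ (List.foldl δ x0 T) : T ∈ S}`, the answer to the SLFV problem on `S`. -/
theorem stmt5 [Countable ID] {Y : Type*} (δ : X → U → X) (ψ : X → Y) (x0 : X)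
    (S : Finset (List U)) (hne : ∀ T ∈ S, T ≠ [])
    (C : List (SimCmd U ID)) (hexec : Executable δ x0 C)
    (hperm : (outputs δ x0 C).Perm S.toList) :
    collected δ ψ x0 C = (outputs δ x0 C).map (fun T => ψ (List.foldl δ x0 T)) ∧
    {y | y ∈ collected δ ψ x0 C} = {y | ∃ T ∈ S, y = ψ (List.foldl δ x0 T)} := by
  have h : collected δ ψ x0 C = (outputs δ x0 C).map (fun T => ψ (List.foldl δ x0 T)) :=
    collectedFrom_eq_map_outputsFrom ψ C (SimState.consistent_initState δ x0)
  refine ⟨h, ?_⟩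
  ext y
  simp [h, hperm.mem_iff, eq_comm]
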